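/- Assume Re k > 0, L > 0, s ≥ 1, and that for every real t ≥ 0 and every pair of signs σ, τ ∈ {+1, −1}, one has 1 − e^{τ·iβ − σ·(t − ik)·L} ≠ 0. Then the function h : ℝ → ℂ is Lebesgue-integrable on the interval (0, ∞). In particular, the integral representation ∫₀^∞ h(t) dt of the Schlömilch series is convergent even when Im β ≠ 0 or Im k ≠ 0. -/

import Mathlib

open Complex Filter Asymptotics MeasureTheory

/-- The branch function `R(ξ) = (ξ² - k²)^{1/2}` with the principal complex square root. -/
noncomputable def schR (k ξ : ℂ) : ℂ := (ξ ^ 2 - k ^ 2) ^ ((1 : ℂ) / 2)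

/-- The function `f_n` appearing in the integral representation of the Schlömilch series. -/
noncomputable def schF (k β : ℂ) (L : ℝ) (s n : ℤ) (ξ : ℂ) : ℂ :=
  Complex.exp ((s : ℂ) * (-Complex.I * β - schR k ξ * L)) * (ξ - schR k ξ) ^ n /
      (schR k ξ * (1 - Complex.exp (-Complex.I * β - schR k ξ * L))) +
    Complex.exp ((s : ℂ) * (Complex.I * β - schR k ξ * L)) * (ξ + schR k ξ) ^ n /
      (schR k ξ * (1 - Complex.exp (Complex.I * β - schR k ξ * L)))

/-- The steepest-descent path `Q(t) = (t² - 2ikt)^{1/2}` (principal square root). -/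
noncomputable def schQ (k : ℂ) (t : ℝ) : ℂ :=
  ((t : ℂ) ^ 2 - 2 * Complex.I * k * t) ^ ((1 : ℂ) / 2)

/-- The integrand `h(t) = (f_n(Q(t)) + f_n(-Q(t))) (t - ik)/Q(t)` of the integral
representation of the Schlömilch lattice sum. -/
noncomputable def schH (k β : ℂ) (L : ℝ) (s n : ℤ) (t : ℝ) : ℂ :=
  (schF k β L s n (schQ k t) + schF k β L s n (-schQ k t)) *
    ((t : ℂ) - Complex.I * k) / schQ k t

lemma sch_half_sq (z : ℂ) : (z ^ ((1 : ℂ) / 2)) ^ 2 = z := by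
  have := Complex.cpow_nat_inv_pow z (n := 2) (by norm_num)
  simpa using this

lemma sch_half_re (z : ℂ) : 0 ≤ (z ^ ((1 : ℂ) / 2)).re := by
  by_cases hz : z = 0
  · subst hz; simp
  rw [Complex.cpow_def_of_ne_zero hz, Complex.exp_re]
  apply mul_nonneg (Real.exp_pos _).le
  have h1 : (Complex.log z * (1 / 2)).im = z.arg / 2 := by
    have : (1 / 2 : ℂ) = ((1 / 2 : ℝ) : ℂ) := by push_cast; ring
    rw [this, Complex.im_mul_ofReal, Complex.log_im]; ring
  rw [h1]
  apply Real.cos_nonneg_of_mem_Icc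
  constructor
  · linarith [Complex.neg_pi_lt_arg z]
  · linarith [Complex.arg_le_pi z]

lemma sch_Q_sq (k : ℂ) (t : ℝ) : schQ k t ^ 2 = (t : ℂ) ^ 2 - 2 * Complex.I * k * t :=
  sch_half_sq _

lemma sch_R_neg (k ξ : ℂ) : schR k (-ξ) = schR k ξ := by simp [schR]

lemma sch_R_sq (k : ℂ) (t : ℝ) : schR k (schQ k t) ^ 2 = ((t : ℂ) - Complex.I * k) ^ 2 := by
  rw [schR, sch_half_sq, sch_Q_sq]
  linear_combination (-k ^ 2) * Complex.I_sq

lemma sch_R_cases (k : ℂ) (t : ℝ) : ∃ σ : ℂ, (σ = 1 ∨ σ = -1) ∧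
    schR k (schQ k t) = σ * ((t : ℂ) - Complex.I * k) := by
  rcases sq_eq_sq_iff_eq_or_eq_neg.1 (sch_R_sq k t) with h | h
  · exact ⟨1, Or.inl rfl, by rw [h]; ring⟩
  · exact ⟨-1, Or.inr rfl, by rw [h]; ring⟩

lemma sch_R_re (k : ℂ) (t : ℝ) : t + k.im ≤ (schR k (schQ k t)).re := by
  have h0 : 0 ≤ (schR k (schQ k t)).re := sch_half_re _
  obtain ⟨σ, h, hR⟩ := sch_R_cases k t
  rw [hR] at h0 ⊢
  rcases h with rfl | rfl
  · simp
  · simp at h0 ⊢; linarith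

lemma sch_R_norm (k : ℂ) (t : ℝ) : ‖schR k (schQ k t)‖ = ‖(t : ℂ) - Complex.I * k‖ := by
  obtain ⟨σ, h, hR⟩ := sch_R_cases k t
  rw [hR]
  rcases h with rfl | rfl <;> simp [-neg_sub]

lemma sch_R_ne (k : ℂ) (hk : 0 < k.re) (t : ℝ) : schR k (schQ k t) ≠ 0 := by
  rw [← norm_ne_zero_iff, sch_R_norm, norm_ne_zero_iff]
  intro h
  have := congrArg Complex.im h
  simp at this
  linarith

lemma sch_tk_norm (k : ℂ) (t : ℝ) (ht : 0 ≤ t) : ‖(t : ℂ) - Complex.I * k‖ ≤ t + ‖k‖ := by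
  refine (norm_sub_le _ _).trans ?_
  simp [abs_of_nonneg ht]

lemma sch_Q_norm_le (k : ℂ) (t : ℝ) (ht : 0 ≤ t) : ‖schQ k t‖ ≤ t + ‖k‖ := by
  have hk := norm_nonneg k
  apply le_of_sq_le_sq _ (by positivity)
  rw [← norm_pow, sch_Q_sq]
  refine (norm_sub_le _ _).trans ?_
  simp [abs_of_nonneg ht]
  nlinarith [sq_nonneg ‖k‖]

lemma sch_Q_norm_ge (k : ℂ) (t : ℝ) (hk : 0 < k.re) (ht : 0 ≤ t) :
    Real.sqrt (2 * k.re) * Real.sqrt t ≤ ‖schQ k t‖ := by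
  rw [← Real.sqrt_mul (by positivity)]
  apply Real.sqrt_le_iff.2 ⟨norm_nonneg _, ?_⟩
  rw [← norm_pow, sch_Q_sq]
  refine le_trans ?_ (Complex.abs_im_le_norm _)
  have : ((t : ℂ) ^ 2 - 2 * Complex.I * k * t).im = - (2 * k.re * t) := by
    simp [pow_two]
  rw [this, abs_neg]
  exact le_abs_self _

lemma sch_exp_norm (k β : ℂ) (L : ℝ) (hL : 0 < L) (τ : ℂ) (hτ : τ = 1 ∨ τ = -1) (t : ℝ) :
    (τ * Complex.I * β - schR k (schQ k t) * L).re ≤ (‖β‖ - L * k.im) - L * t := by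
  have h1 : (τ * Complex.I * β).re ≤ ‖β‖ := by
    refine (Complex.re_le_norm _).trans ?_
    rcases hτ with rfl | rfl <;> simp
  have h2 := sch_R_re k t
  rw [Complex.sub_re, Complex.re_mul_ofReal]
  nlinarith

lemma sch_den (k β : ℂ) (L : ℝ) (hL : 0 < L)
    (hden : ∀ t : ℝ, 0 ≤ t → ∀ σ τ : ℂ, (σ = 1 ∨ σ = -1) → (τ = 1 ∨ τ = -1) →
      1 - Complex.exp (τ * Complex.I * β - σ * ((t : ℂ) - Complex.I * k) * L) ≠ 0) :
    ∃ c > 0, ∀ t : ℝ, 0 ≤ t → ∀ τ : ℂ, (τ = 1 ∨ τ = -1) →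
      c ≤ ‖1 - Complex.exp (τ * Complex.I * β - schR k (schQ k t) * L)‖ := by
  obtain ⟨T, hT⟩ : ∃ T : ℝ, (‖β‖ - L * k.im) - L * T ≤ Real.log (1 / 2) :=
    ⟨(‖β‖ - L * k.im - Real.log (1 / 2)) / L, by field_simp; linarith⟩
  have key : ∀ σ τ : ℂ, (σ = 1 ∨ σ = -1) → (τ = 1 ∨ τ = -1) → ∃ c > 0, ∀ t ∈ Set.Icc 0 T,
      c ≤ ‖1 - Complex.exp (τ * Complex.I * β - σ * ((t : ℂ) - Complex.I * k) * L)‖ := by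
    intro σ τ hσ hτ
    refine isCompact_Icc.exists_forall_le' (f := fun t : ℝ =>
      ‖1 - Complex.exp (τ * Complex.I * β - σ * ((t : ℂ) - Complex.I * k) * L)‖) ?_ ?_
    · fun_prop
    · intro t ht
      exact norm_pos_iff.2 (hden t ht.1 σ τ hσ hτ)
  obtain ⟨c1, hc1, h1⟩ := key 1 1 (by simp) (by simp)
  obtain ⟨c2, hc2, h2⟩ := key 1 (-1) (by simp) (by simp)
  obtain ⟨c3, hc3, h3⟩ := key (-1) 1 (by simp) (by simp)
  obtain ⟨c4, hc4, h4⟩ := key (-1) (-1) (by simp) (by simp)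
  refine ⟨min (1 / 2) (min (min c1 c2) (min c3 c4)), by positivity, ?_⟩
  intro t ht τ hτ
  rcases le_total t T with h | h
  · obtain ⟨σ, hσ, hR⟩ := sch_R_cases k t
    rw [hR]
    rcases hσ with rfl | rfl <;> rcases hτ with rfl | rfl
    · exact le_trans (by simp) (h1 t ⟨ht, h⟩)
    · exact le_trans (by simp) (h2 t ⟨ht, h⟩)
    · exact le_trans (by simp) (h3 t ⟨ht, h⟩)
    · exact le_trans (by simp) (h4 t ⟨ht, h⟩)
  · refine (min_le_left _ _).trans ?_
    have h5 := sch_exp_norm k β L hL τ hτ t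
    have h6 : ‖Complex.exp (τ * Complex.I * β - schR k (schQ k t) * L)‖ ≤ 1 / 2 := by
      rw [Complex.norm_exp, ← Real.le_log_iff_exp_le (by norm_num)]
      nlinarith
    have h7 := norm_sub_norm_le (1 : ℂ) (Complex.exp (τ * Complex.I * β - schR k (schQ k t) * L))
    rw [norm_one] at h7
    linarith

lemma sch_zpow (w : ℂ) (A : ℝ) (n : ℤ) (h1 : ‖w‖ ≤ A) (h2 : ‖w⁻¹‖ ≤ A) :
    ‖w ^ n‖ ≤ A ^ n.natAbs := by
  rcases Int.natAbs_eq n with h | h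
  · rw [h, zpow_natCast, norm_pow, Int.natAbs_natCast]
    exact pow_le_pow_left₀ (norm_nonneg _) h1 _
  · rw [h, zpow_neg, zpow_natCast, ← inv_pow, norm_pow, Int.natAbs_neg, Int.natAbs_natCast]
    exact pow_le_pow_left₀ (norm_nonneg _) h2 _

lemma sch_w (k w w' : ℂ) (hk : k ≠ 0) (h : w * w' = k ^ 2 ∨ w * w' = - k ^ 2) (t : ℝ) (ht : 0 ≤ t)
    (hw : ‖w‖ ≤ 2 * (t + ‖k‖)) (hw' : ‖w'‖ ≤ 2 * (t + ‖k‖)) (n : ℤ) :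
    ‖w ^ n‖ ≤ (2 * (1 + ‖k‖) * (1 + 1 / ‖k‖ ^ 2) * (1 + t)) ^ n.natAbs := by
  have hk' : 0 < ‖k‖ := norm_pos_iff.2 hk
  have hb : 2 * (t + ‖k‖) ≤ 2 * (1 + ‖k‖) * (1 + t) := by nlinarith
  have hi : 0 < 1 / ‖k‖ ^ 2 := by positivity
  have hp : 0 ≤ 2 * (1 + ‖k‖) * (1 + t) := by positivity
  apply sch_zpow
  · nlinarith
  · have hn : ‖w‖ * ‖w'‖ = ‖k‖ ^ 2 := by
      rw [← norm_mul]; rcases h with h | h <;> simp [h]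
    have hw0 : ‖w‖ ≠ 0 := by
      intro h0; rw [h0, zero_mul] at hn; exact (pow_pos hk' 2).ne hn
    have : ‖w⁻¹‖ = ‖w'‖ * (1 / ‖k‖ ^ 2) := by
      rw [norm_inv, ← hn]; 
      have : ‖w'‖ ≠ 0 := by
        intro h0; rw [h0, mul_zero] at hn; exact (pow_pos hk' 2).ne hn
      field_simp
    rw [this]
    have : ‖w'‖ * (1 / ‖k‖ ^ 2) ≤ 2 * (1 + ‖k‖) * (1 + t) * (1 / ‖k‖ ^ 2) :=
      mul_le_mul_of_nonneg_right (hw'.trans hb) hi.le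
    nlinarith

lemma sch_term (k β : ℂ) (L : ℝ) (s : ℤ) (hk : 0 < k.re) (hs : 1 ≤ s) (hL : 0 < L) (c : ℝ)
    (hc : 0 < c) (τ : ℂ) (hτ : τ = 1 ∨ τ = -1) (t : ℝ) (ht : 0 ≤ t)
    (hd : c ≤ ‖1 - Complex.exp (τ * Complex.I * β - schR k (schQ k t) * L)‖)
    (W : ℂ) (B : ℝ) (hW : ‖W‖ ≤ B) :
    ‖Complex.exp ((s : ℂ) * (τ * Complex.I * β - schR k (schQ k t) * L)) * W /
      (schR k (schQ k t) * (1 - Complex.exp (τ * Complex.I * β - schR k (schQ k t) * L)))‖ ≤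
    Real.exp (s * (‖β‖ - L * k.im)) * Real.exp (- L * t) * B / c / ‖(t : ℂ) - Complex.I * k‖ := by
  have hR : 0 < ‖schR k (schQ k t)‖ := norm_pos_iff.2 (sch_R_ne k hk t)
  have hs' : (1 : ℝ) ≤ s := by exact_mod_cast hs
  rw [norm_div, norm_mul, norm_mul, ← sch_R_norm, div_div, mul_comm c]
  have he : ‖Complex.exp ((s : ℂ) * (τ * Complex.I * β - schR k (schQ k t) * L))‖ ≤
      Real.exp (s * (‖β‖ - L * k.im)) * Real.exp (- L * t) := by
    rw [Complex.norm_exp, ← Real.exp_add]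
    apply Real.exp_le_exp.2
    have h1 := sch_exp_norm k β L hL τ hτ t
    have h2 : ((s : ℂ) * (τ * Complex.I * β - schR k (schQ k t) * L)).re =
        s * (τ * Complex.I * β - schR k (schQ k t) * L).re := by
      have : (s : ℂ) = ((s : ℝ) : ℂ) := by push_cast; rfl
      rw [this, Complex.re_ofReal_mul]
    rw [h2]
    have h3 := mul_le_mul_of_nonneg_left h1 (by linarith : (0 : ℝ) ≤ s)
    have h4 : L * t ≤ s * (L * t) := le_mul_of_one_le_left (by positivity) hs'
    linarith
  have hB : 0 ≤ B := (norm_nonneg _).trans hW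
  gcongr

lemma sch_F (k β : ℂ) (L : ℝ) (s n : ℤ) (hk : 0 < k.re) (hs : 1 ≤ s) (hL : 0 < L) (c : ℝ)
    (hc : 0 < c) (t : ℝ) (ht : 0 ≤ t)
    (hd : ∀ τ : ℂ, (τ = 1 ∨ τ = -1) →
      c ≤ ‖1 - Complex.exp (τ * Complex.I * β - schR k (schQ k t) * L)‖)
    (ξ : ℂ) (hξ : ξ = schQ k t ∨ ξ = - schQ k t) :
    ‖schF k β L s n ξ‖ ≤ 2 * (Real.exp (s * (‖β‖ - L * k.im)) * Real.exp (- L * t) *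
      (2 * (1 + ‖k‖) * (1 + 1 / ‖k‖ ^ 2) * (1 + t)) ^ n.natAbs / c /
        ‖(t : ℂ) - Complex.I * k‖) := by
  have hR : schR k ξ = schR k (schQ k t) := by
    rcases hξ with rfl | rfl
    · rfl
    · exact sch_R_neg _ _
  have hn : ‖ξ‖ ≤ t + ‖k‖ := by
    rcases hξ with rfl | rfl
    · exact sch_Q_norm_le k t ht
    · rw [norm_neg]; exact sch_Q_norm_le k t ht
  have hRn : ‖schR k (schQ k t)‖ ≤ t + ‖k‖ := by
    rw [sch_R_norm]; exact sch_tk_norm k t ht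
  have hk0 : k ≠ 0 := by rintro rfl; simp at hk
  have hsq : ξ ^ 2 - schR k (schQ k t) ^ 2 = k ^ 2 := by
    have : ξ ^ 2 = schQ k t ^ 2 := by rcases hξ with rfl | rfl <;> ring
    rw [this, schR, sch_half_sq]; ring
  have hm : ‖ξ - schR k (schQ k t)‖ ≤ 2 * (t + ‖k‖) := (norm_sub_le _ _).trans (by linarith)
  have hp : ‖ξ + schR k (schQ k t)‖ ≤ 2 * (t + ‖k‖) := (norm_add_le _ _).trans (by linarith)
  have w1 := sch_w k _ _ hk0 (Or.inl (by rw [← hsq]; ring)) t ht hm hp n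
  have w2 := sch_w k _ _ hk0 (Or.inl (by rw [← hsq]; ring)) t ht hp hm n
  have t1 := sch_term k β L s hk hs hL c hc (-1) (by simp) t ht (hd (-1) (by simp)) _ _ w1
  have t2 := sch_term k β L s hk hs hL c hc 1 (by simp) t ht (hd 1 (by simp)) _ _ w2
  rw [schF, hR]
  refine (norm_add_le _ _).trans ?_
  rw [neg_one_mul] at t1
  rw [one_mul] at t2
  linarith

lemma sch_poly (L : ℝ) (hL : 0 < L) (N : ℕ) (t : ℝ) (ht : 0 ≤ t) :
    (1 + t) ^ N * Real.exp (- L * t) ≤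
      (N.factorial * (2 / L) ^ N * Real.exp (L / 2)) * Real.exp (-(L / 2) * t) := by
  have h := Real.pow_div_factorial_le_exp ((1 + t) * (L / 2)) (by positivity) N
  rw [div_le_iff₀ (by positivity), mul_pow] at h
  have h1 : (1 + t) ^ N = (2 / L) ^ N * ((1 + t) ^ N * (L / 2) ^ N) := by
    have : (2 / L) ^ N * (L / 2) ^ N = 1 := by
      rw [← mul_pow]; field_simp; simp
    linear_combination (-(1 + t) ^ N) * this
  have h2 : Real.exp (L / 2) * Real.exp (-(L / 2) * t) =
      Real.exp ((1 + t) * (L / 2)) * Real.exp (- L * t) := by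
    rw [← Real.exp_add, ← Real.exp_add]; ring_nf
  calc (1 + t) ^ N * Real.exp (- L * t)
      ≤ (2 / L) ^ N * (Real.exp ((1 + t) * (L / 2)) * N.factorial) * Real.exp (- L * t) := by
        rw [h1]; gcongr
    _ = _ := by linear_combination (-(N.factorial : ℝ) * (2 / L) ^ N) * h2

lemma sch_zpow_meas (n : ℤ) : Measurable (fun z : ℂ => z ^ n) := by
  rcases Int.natAbs_eq n with h | h
  · rw [h]; simp only [zpow_natCast]; fun_prop
  · rw [h]; simp only [zpow_neg, zpow_natCast]; fun_prop

lemma sch_R_meas (k : ℂ) : Measurable (schR k) := by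
  unfold schR; fun_prop

lemma sch_Q_meas (k : ℂ) : Measurable (schQ k) := by
  unfold schQ; fun_prop

lemma sch_F_meas (k β : ℂ) (L : ℝ) (s n : ℤ) : Measurable (schF k β L s n) := by
  have h1 := sch_R_meas k
  have h2 : Measurable (fun ξ => (ξ - schR k ξ) ^ n) :=
    (sch_zpow_meas n).comp (measurable_id.sub h1)
  have h3 : Measurable (fun ξ => (ξ + schR k ξ) ^ n) :=
    (sch_zpow_meas n).comp (measurable_id.add h1)
  unfold schF; fun_prop

lemma sch_H_meas (k β : ℂ) (L : ℝ) (s n : ℤ) : Measurable (schH k β L s n) := by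
  have h1 := sch_Q_meas k
  have h2 : Measurable (fun t => schF k β L s n (schQ k t)) := (sch_F_meas k β L s n).comp h1
  have h3 : Measurable (fun t => schF k β L s n (-schQ k t)) :=
    (sch_F_meas k β L s n).comp h1.neg
  unfold schH; fun_prop

/-- Convergence of the integral representation of the Schlömilch series: the integrand
is Lebesgue-integrable on `(0, ∞)`, even for complex `β` and `k` (with `Re k > 0`),
provided the denominators `1 - e^{±iβ ∓ (t - ik)L}` never vanish. -/
theorem schH_integrableOn_Ioi (k β : ℂ) (L : ℝ) (s n : ℤ)
    (hk : 0 < k.re) (hs : 1 ≤ s) (hL : 0 < L)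
    (hden : ∀ t : ℝ, 0 ≤ t → ∀ σ τ : ℂ, (σ = 1 ∨ σ = -1) → (τ = 1 ∨ τ = -1) →
      1 - Complex.exp (τ * Complex.I * β - σ * ((t : ℂ) - Complex.I * k) * L) ≠ 0) :
    IntegrableOn (fun t : ℝ => schH k β L s n t) (Set.Ioi 0) := by
  obtain ⟨c, hc, hd⟩ := sch_den k β L hL hden
  have hint : IntegrableOn (fun t : ℝ => t ^ (-(1 / 2) : ℝ) * Real.exp (-(L / 2) * t))
      (Set.Ioi 0) := by
    have := integrableOn_rpow_mul_exp_neg_mul_rpow (p := 1) (s := -(1 / 2)) (b := L / 2)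
      (by norm_num) (by norm_num) (by positivity)
    simpa using this
  set E := Real.exp (s * (‖β‖ - L * k.im)) with hE
  set M := 2 * (1 + ‖k‖) * (1 + 1 / ‖k‖ ^ 2) with hM
  set N := n.natAbs with hN
  set K := (N.factorial * (2 / L) ^ N * Real.exp (L / 2)) with hK
  have hM0 : 0 ≤ M := by positivity
  have hE0 : 0 ≤ E := (Real.exp_pos _).le
  refine Integrable.mono' (hint.const_mul (4 * E * M ^ N / c * K / Real.sqrt (2 * k.re)))
    (sch_H_meas k β L s n).aestronglyMeasurable ?_
  refine (ae_restrict_mem measurableSet_Ioi).mono fun t ht => ?_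
  have ht : 0 < t := ht
  have hF := sch_F k β L s n hk hs hL c hc t ht.le (hd t ht.le)
  have hF1 := hF _ (Or.inl rfl)
  have hF2 := hF _ (Or.inr rfl)
  have hR : 0 < ‖(t : ℂ) - Complex.I * k‖ := by
    rw [← sch_R_norm]; exact norm_pos_iff.2 (sch_R_ne k hk t)
  have hq := sch_Q_norm_ge k t hk ht.le
  have hq0 : 0 < Real.sqrt (2 * k.re) * Real.sqrt t := by positivity
  have hpoly := sch_poly L hL N t ht.le
  have hsum : ‖schF k β L s n (schQ k t) + schF k β L s n (-schQ k t)‖ *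
      ‖(t : ℂ) - Complex.I * k‖ ≤ 4 * (E * Real.exp (- L * t) * (M * (1 + t)) ^ N / c) := by
    rw [← le_div_iff₀ hR]
    refine (norm_add_le _ _).trans ?_
    refine (add_le_add hF1 hF2).trans (le_of_eq ?_)
    ring
  rw [schH, norm_div, norm_mul]
  calc _ ≤ 4 * (E * Real.exp (- L * t) * (M * (1 + t)) ^ N / c) /
        (Real.sqrt (2 * k.re) * Real.sqrt t) := by gcongr
    _ = 4 * E * M ^ N / c * ((1 + t) ^ N * Real.exp (- L * t)) /
        (Real.sqrt (2 * k.re) * Real.sqrt t) := by rw [mul_pow]; ring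
    _ ≤ 4 * E * M ^ N / c * (K * Real.exp (-(L / 2) * t)) /
        (Real.sqrt (2 * k.re) * Real.sqrt t) := by gcongr
    _ = _ := by
      rw [Real.rpow_neg ht.le, ← Real.sqrt_eq_rpow]
      field_simp
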